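/- Every nonzero multiplicative linear functional on the commutative C*-algebra A# generated by CS(ℝ) and P_{2π} is either an evaluation w_t(f) = f(t) for some t ∈ ℝ, or one of the functionals w_{θ,±}(f) = lim_{k→∞} f(θ ± 2πk) for some θ ∈ ℝ (these limits exist for every f ∈ A#). Moreover the evaluations {w_t : t ∈ ℝ} are dense in the spectrum of A#. -/

import Mathlib

open Filter Topology Real BoundedContinuousFunction WeakDual

/-- Bounded continuous functions on `ℝ` with limits at `±∞` (`CS(ℝ)`). -/
def CSset : Set (ℝ →ᵇ ℂ) :=
  {f | (∃ l : ℂ, Tendsto f atTop (𝓝 l)) ∧ ∃ l : ℂ, Tendsto f atBot (𝓝 l)}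

/-- Continuous `2π`-periodic functions `P_{2π}`. -/
def P2pi : Set (ℝ →ᵇ ℂ) := {f | Function.Periodic f (2 * π)}

/-- `A#`: the closure in `C_b(ℝ)` of the algebra generated by `CS(ℝ)` and `P_{2π}`. -/
noncomputable def Asharp : Subalgebra ℂ (ℝ →ᵇ ℂ) :=
  (Algebra.adjoin ℂ (CSset ∪ P2pi)).topologicalClosure

section Convergence

variable {X : Type*} [TopologicalSpace X]

/-- If a set of bounded continuous functions converges along a nontrivial filter, so does every
function in the closed subalgebra it generates. -/
theorem exists_tendsto_of_mem_topologicalClosure_adjoin {s : Set (X →ᵇ ℂ)} {F : Filter X} [F.NeBot]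
    (hs : ∀ f ∈ s, ∃ l : ℂ, Tendsto f F (𝓝 l)) {f : X →ᵇ ℂ}
    (hf : f ∈ (Algebra.adjoin ℂ s).topologicalClosure) : ∃ l : ℂ, Tendsto f F (𝓝 l) := by
  have hadj : ∀ g ∈ Algebra.adjoin ℂ s, ∃ l : ℂ, Tendsto g F (𝓝 l) := by
    intro g hg
    induction hg using Algebra.adjoin_induction with
    | mem g hg => exact hs g hg
    | algebraMap r => exact ⟨r, tendsto_const_nhds.congr fun x => by simp⟩
    | add g₁ g₂ _ _ h₁ h₂ =>
      obtain ⟨l₁, h₁⟩ := h₁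
      obtain ⟨l₂, h₂⟩ := h₂
      exact ⟨l₁ + l₂, h₁.add h₂⟩
    | mul g₁ g₂ _ _ h₁ h₂ =>
      obtain ⟨l₁, h₁⟩ := h₁
      obtain ⟨l₂, h₂⟩ := h₂
      exact ⟨l₁ * l₂, h₁.mul h₂⟩
  suffices Cauchy (map f F) from CompleteSpace.complete this
  refine Metric.cauchy_iff.2 ⟨inferInstance, fun ε hε => ?_⟩
  obtain ⟨g, hg, hfg⟩ := Metric.mem_closure_iff.1 hf (ε / 4) (by positivity)
  obtain ⟨l, hl⟩ := hadj g hg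
  refine ⟨f '' {x | dist (g x) l < ε / 4},
    image_mem_map (hl.eventually (Metric.ball_mem_nhds l (by positivity))), ?_⟩
  rintro _ ⟨x, hx, rfl⟩ _ ⟨y, hy, rfl⟩
  have hfx := (dist_coe_le_dist (f := f) (g := g) x).trans_lt hfg
  have hfy := (dist_coe_le_dist (f := f) (g := g) y).trans_lt hfg
  have hx' : dist (g x) l < ε / 4 := hx
  have hy' : dist (g y) l < ε / 4 := hy
  have h₁ := dist_triangle4 (f x) (g x) (g y) (f y)
  have h₂ := dist_triangle_right (g x) (g y) l
  rw [dist_comm (g y)] at h₁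
  linarith

/-- A closed subalgebra generated by a star-closed set is star-closed. -/
theorem star_mem_topologicalClosure_adjoin {s : Set (X →ᵇ ℂ)} (hs : ∀ f ∈ s, star f ∈ s)
    {f : X →ᵇ ℂ} (hf : f ∈ (Algebra.adjoin ℂ s).topologicalClosure) :
    star f ∈ (Algebra.adjoin ℂ s).topologicalClosure := by
  refine map_mem_closure continuous_star hf fun g hg => ?_
  induction hg using Algebra.adjoin_induction with
  | mem g hg => exact Algebra.subset_adjoin (hs g hg)
  | algebraMap r =>
    rw [← algebraMap_star_comm]
    exact Subalgebra.algebraMap_mem _ _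
  | add g₁ g₂ _ _ h₁ h₂ => simpa using add_mem h₁ h₂
  | mul g₁ g₂ _ _ h₁ h₂ => simpa using mul_mem h₁ h₂

end Convergence

section Evaluation

variable {X : Type*} [TopologicalSpace X] {B : Subalgebra ℂ (X →ᵇ ℂ)}

/-- Evaluation at a point, as a character of a subalgebra of bounded continuous functions. -/
noncomputable def evalCharacter (B : Subalgebra ℂ (X →ᵇ ℂ)) (x : X) : characterSpace ℂ B :=
  ⟨((evalCLM ℂ x).comp B.toSubmodule.subtypeL : B →L[ℂ] ℂ), by
    rw [CharacterSpace.eq_set_map_one_map_mul]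
    exact ⟨rfl, fun _ _ => rfl⟩⟩

@[simp]
theorem evalCharacter_apply (x : X) (f : B) : evalCharacter B x f = (f : X →ᵇ ℂ) x := rfl

/-- On finitely many elements of a closed star-closed algebra of bounded continuous functions,
every character is approximated by evaluations. -/
theorem exists_norm_apply_sub_character_lt [Nonempty X] (hB : IsClosed (B : Set (X →ᵇ ℂ)))
    (hstar : ∀ f ∈ B, star f ∈ B) (φ : characterSpace ℂ B) (I : Finset B) {δ : ℝ} (hδ : 0 < δ) :
    ∃ x : X, ∀ f ∈ I, ‖(f : X →ᵇ ℂ) x - φ f‖ < δ := by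
  by_contra! hfar
  have : CompleteSpace B := hB.completeSpace_coe
  let d : B → B := fun f => f - algebraMap ℂ B (φ f)
  let g : B := ∑ f ∈ I, ⟨star (d f : X →ᵇ ℂ), hstar _ (d f).2⟩ * d f
  have hφg : φ g = 0 := by
    simp [g, d, map_sum, AlgHomClass.commutes]
  have hgx (x : X) : (g : X →ᵇ ℂ) x = (∑ f ∈ I, ‖(f : X →ᵇ ℂ) x - φ f‖ ^ 2 : ℝ) := by
    simp only [g, AddSubmonoidClass.coe_finsetSum, BoundedContinuousFunction.coe_sum,
      Finset.sum_apply, Complex.ofReal_sum]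
    refine Finset.sum_congr rfl fun f _ => ?_
    rw [Complex.ofReal_pow, ← Complex.conj_mul']
    rfl
  have hlow (x : X) : δ ^ 2 ≤ ∑ f ∈ I, ‖(f : X →ᵇ ℂ) x - φ f‖ ^ 2 := by
    obtain ⟨f, hf, hfx⟩ := hfar x
    calc δ ^ 2 ≤ ‖(f : X →ᵇ ℂ) x - φ f‖ ^ 2 := by gcongr
      _ ≤ _ := Finset.single_le_sum (f := fun f : B => ‖(f : X →ᵇ ℂ) x - φ f‖ ^ 2)
        (fun _ _ => sq_nonneg _) hf
  have hup (x : X) : ∑ f ∈ I, ‖(f : X →ᵇ ℂ) x - φ f‖ ^ 2 ≤ ‖g‖ := by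
    have h := (g : X →ᵇ ℂ).norm_coe_le_norm x
    rw [hgx, Complex.norm_real] at h
    exact (le_abs_self _).trans h
  have hpos : 0 < ‖g‖ + δ ^ 2 := by positivity
  set c : ℝ := (‖g‖ + δ ^ 2)⁻¹ with hc
  have hc0 : 0 < c := inv_pos.2 hpos
  have hc1 : c * ‖g‖ + c * δ ^ 2 = 1 := by rw [← mul_add, hc, inv_mul_cancel₀ hpos.ne']
  have hcg : 0 ≤ c * ‖g‖ := by positivity
  have hnorm : ‖1 - (c : ℂ) • g‖ ≤ 1 - c * δ ^ 2 := by
    refine (BoundedContinuousFunction.norm_le (by linarith)).2 fun x => ?_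
    have hx : ((1 - (c : ℂ) • g : B) : X →ᵇ ℂ) x =
        (1 - c * ∑ f ∈ I, ‖(f : X →ᵇ ℂ) x - φ f‖ ^ 2 : ℝ) := by
      rw [Complex.ofReal_sub, Complex.ofReal_mul, ← hgx]
      simp
    change ‖((1 - (c : ℂ) • g : B) : X →ᵇ ℂ) x‖ ≤ _
    rw [hx, Complex.norm_real, Real.norm_eq_abs, abs_le]
    have h₁ := mul_le_mul_of_nonneg_left (hlow x) hc0.le
    have h₂ := mul_le_mul_of_nonneg_left (hup x) hc0.le
    have h₃ : 0 < c * δ ^ 2 := by positivity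
    constructor <;> linarith
  have : NormOneClass B := ⟨norm_one (α := X →ᵇ ℂ)⟩
  have hφ : ‖φ (1 - (c : ℂ) • g)‖ ≤ ‖1 - (c : ℂ) • g‖ := AlgHom.norm_apply_le_self φ _
  rw [map_sub, map_smul, hφg, map_one, smul_zero, sub_zero, norm_one] at hφ
  have : 0 < c * δ ^ 2 := by positivity
  linarith

/-- Evaluations are dense in the character space of a closed star-closed algebra of bounded
continuous functions. -/
theorem denseRange_evalCharacter [Nonempty X] (hB : IsClosed (B : Set (X →ᵇ ℂ)))
    (hstar : ∀ f ∈ B, star f ∈ B) : DenseRange (evalCharacter B) := by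
  intro φ
  have hind : IsInducing (fun (ψ : characterSpace ℂ B) (f : B) => ψ f) :=
    (⟨rfl⟩ : IsInducing fun (ψ : WeakDual ℂ B) (f : B) => ψ f).comp IsInducing.subtypeVal
  rw [hind.closure_eq_preimage_closure_image, Set.mem_preimage, mem_closure_iff_nhds]
  intro t ht
  rw [nhds_pi, Filter.mem_pi'] at ht
  obtain ⟨I, u, hu, hut⟩ := ht
  have hev : ∀ᶠ δ : ℝ in 𝓝[>] 0, ∀ f ∈ I, Metric.ball (φ f) δ ⊆ u f := by
    refine (Filter.eventually_all_finset I).2 fun f _ => ?_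
    obtain ⟨ε, hε, hεu⟩ := Metric.mem_nhds_iff.1 (hu f)
    filter_upwards [Ioo_mem_nhdsGT hε] with δ hδ
    exact (Metric.ball_subset_ball hδ.2.le).trans hεu
  obtain ⟨δ, hδI, hδ⟩ := (hev.and self_mem_nhdsWithin).exists
  obtain ⟨x, hx⟩ := exists_norm_apply_sub_character_lt hB hstar φ I hδ
  exact ⟨_, hut fun f hf => hδI f hf (mem_ball_iff_norm.2 (hx f hf)),
    Set.mem_image_of_mem _ (Set.mem_range_self x)⟩

/-- Every character of a closed star-closed algebra of bounded continuous functions is the limit of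
evaluations along an ultrafilter. -/
theorem exists_ultrafilter_tendsto_character [Nonempty X] (hB : IsClosed (B : Set (X →ᵇ ℂ)))
    (hstar : ∀ f ∈ B, star f ∈ B) (φ : characterSpace ℂ B) :
    ∃ U : Ultrafilter X, ∀ f : B, Tendsto (f : X →ᵇ ℂ) U (𝓝 (φ f)) := by
  have : (comap (evalCharacter B) (𝓝 φ)).NeBot :=
    comap_neBot_iff.2 fun t ht => by
      obtain ⟨_, hxt, x, rfl⟩ := mem_closure_iff_nhds.1 (denseRange_evalCharacter hB hstar φ) t ht
      exact ⟨x, hxt⟩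
  refine ⟨Ultrafilter.of (comap (evalCharacter B) (𝓝 φ)), fun f => ?_⟩
  have hcont : Continuous fun ψ : characterSpace ℂ B => ψ f :=
    (WeakDual.eval_continuous f).comp continuous_subtype_val
  exact (hcont.tendsto φ).comp (tendsto_comap.mono_left (Ultrafilter.of_le _))

end Evaluation

theorem star_mem_CSset_union_P2pi {f : ℝ →ᵇ ℂ} (hf : f ∈ CSset ∪ P2pi) :
    star f ∈ CSset ∪ P2pi := by
  rcases hf with ⟨⟨a, ha⟩, b, hb⟩ | hf
  · exact Or.inl ⟨⟨star a, ha.star⟩, star b, hb.star⟩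
  · exact Or.inr fun x => congrArg star (hf x)

theorem isClosed_Asharp : IsClosed (Asharp : Set (ℝ →ᵇ ℂ)) :=
  Subalgebra.isClosed_topologicalClosure _

theorem star_mem_Asharp {f : ℝ →ᵇ ℂ} (hf : f ∈ Asharp) : star f ∈ Asharp :=
  star_mem_topologicalClosure_adjoin (fun _ => star_mem_CSset_union_P2pi) hf

/-- A continuous periodic function converges along a filter converging in the circle. -/
theorem Function.Periodic.tendsto_of_tendsto_addCircle {f : ℝ → ℂ} {p θ : ℝ}
    (hf : Function.Periodic f p) (hcont : Continuous f) {F : Filter ℝ}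
    (hF : Tendsto (fun x : ℝ => (x : AddCircle p)) F (𝓝 (θ : AddCircle p))) :
    Tendsto f F (𝓝 (f θ)) := by
  have hlift : Continuous hf.lift := hcont.quotient_lift _
  exact (hlift.tendsto (θ : AddCircle p)).comp hF

/-- Elements of `A#` converge along filters that tend to `±∞` and converge in the circle. -/
theorem exists_tendsto_of_mem_Asharp {f : ℝ →ᵇ ℂ} (hf : f ∈ Asharp) {F : Filter ℝ} [F.NeBot]
    {θ : ℝ} (hF : F ≤ atTop ∨ F ≤ atBot)
    (hθ : Tendsto (fun x : ℝ => (x : AddCircle (2 * π))) F (𝓝 (θ : AddCircle (2 * π)))) :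
    ∃ l : ℂ, Tendsto f F (𝓝 l) := by
  refine exists_tendsto_of_mem_topologicalClosure_adjoin ?_ hf
  rintro g (⟨⟨a, ha⟩, b, hb⟩ | hg)
  · rcases hF with hF | hF
    · exact ⟨a, ha.mono_left hF⟩
    · exact ⟨b, hb.mono_left hF⟩
  · exact ⟨g θ, hg.tendsto_of_tendsto_addCircle g.continuous hθ⟩

theorem tendsto_add_two_pi_mul_atTop (θ : ℝ) :
    Tendsto (fun k : ℕ => θ + 2 * π * k) atTop atTop :=
  tendsto_atTop_add_const_left _ _ (tendsto_natCast_atTop_atTop.const_mul_atTop two_pi_pos)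

theorem tendsto_sub_two_pi_mul_atBot (θ : ℝ) :
    Tendsto (fun k : ℕ => θ - 2 * π * k) atTop atBot := by
  simp only [sub_eq_add_neg]
  exact tendsto_atBot_add_const_left _ _ (tendsto_neg_atTop_atBot.comp
    (tendsto_natCast_atTop_atTop.const_mul_atTop two_pi_pos))

theorem coe_add_two_pi_mul (θ : ℝ) (k : ℕ) :
    ((θ + 2 * π * k : ℝ) : AddCircle (2 * π)) = θ := by
  rw [mul_comm (2 * π), ← nsmul_eq_mul, AddCircle.coe_add, AddCircle.coe_nsmul, AddCircle.coe_period,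
    smul_zero, add_zero]

theorem coe_sub_two_pi_mul (θ : ℝ) (k : ℕ) :
    ((θ - 2 * π * k : ℝ) : AddCircle (2 * π)) = θ := by
  rw [mul_comm (2 * π), ← nsmul_eq_mul, AddCircle.coe_sub, AddCircle.coe_nsmul, AddCircle.coe_period,
    smul_zero, sub_zero]

/-- If elements of `A#` converge along `F`, they converge to the same limits along any sequence
with the same end at infinity and the same limit in the circle. -/
theorem tendsto_comp_of_tendsto_Asharp {f : ℝ →ᵇ ℂ} (hf : f ∈ Asharp) {F : Filter ℝ} [F.NeBot]
    {θ : ℝ} {l : ℂ} {u : ℕ → ℝ} {G : Filter ℝ} (hG : G = atTop ∨ G = atBot) (hF : F ≤ G)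
    (hθ : Tendsto (fun x : ℝ => (x : AddCircle (2 * π))) F (𝓝 (θ : AddCircle (2 * π))))
    (hu : Tendsto u atTop G) (huθ : ∀ k, (u k : AddCircle (2 * π)) = θ)
    (hl : Tendsto f F (𝓝 l)) : Tendsto (fun k => f (u k)) atTop (𝓝 l) := by
  have hle : F ⊔ map u atTop ≤ G := sup_le hF hu
  have huc : Tendsto (fun x : ℝ => (x : AddCircle (2 * π))) (map u atTop)
      (𝓝 (θ : AddCircle (2 * π))) :=
    tendsto_map'_iff.2 (tendsto_const_nhds.congr fun k => (huθ k).symm)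
  obtain ⟨m, hm⟩ := exists_tendsto_of_mem_Asharp hf (F := F ⊔ map u atTop)
    (hG.imp hle.trans_eq hle.trans_eq) (hθ.sup huc)
  rw [tendsto_nhds_unique hl (hm.mono_left le_sup_left)]
  exact tendsto_map'_iff.1 (hm.mono_left le_sup_right)

/-- For every `f ∈ A#` the limits `lim_{k→∞} f(θ ± 2πk)` exist; every character
of `A#` is either an evaluation `w_t` at some `t ∈ ℝ` or one of the functionals
`w_{θ,±} : f ↦ lim_{k→∞} f(θ ± 2πk)`; and the evaluations are dense in the
spectrum of `A#`. -/
theorem stmt_9 :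
    (∀ f : Asharp, ∀ θ : ℝ,
      (∃ l : ℂ, Tendsto (fun k : ℕ => (f : ℝ →ᵇ ℂ) (θ + 2 * π * k)) atTop (𝓝 l)) ∧
      (∃ l : ℂ, Tendsto (fun k : ℕ => (f : ℝ →ᵇ ℂ) (θ - 2 * π * k)) atTop (𝓝 l))) ∧
    (∀ φ : characterSpace ℂ Asharp,
      (∃ t : ℝ, ∀ f : Asharp, φ f = (f : ℝ →ᵇ ℂ) t) ∨
      (∃ θ : ℝ, ∀ f : Asharp,
        Tendsto (fun k : ℕ => (f : ℝ →ᵇ ℂ) (θ + 2 * π * k)) atTop (𝓝 (φ f))) ∨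
      (∃ θ : ℝ, ∀ f : Asharp,
        Tendsto (fun k : ℕ => (f : ℝ →ᵇ ℂ) (θ - 2 * π * k)) atTop (𝓝 (φ f)))) ∧
    Dense {φ : characterSpace ℂ Asharp |
      ∃ t : ℝ, ∀ f : Asharp, φ f = (f : ℝ →ᵇ ℂ) t} := by
  refine ⟨fun f θ => ⟨?_, ?_⟩, fun φ => ?_, ?_⟩
  · refine exists_tendsto_of_mem_Asharp f.2 (F := map (fun k : ℕ => θ + 2 * π * k) atTop) (θ := θ)
      (Or.inl (tendsto_add_two_pi_mul_atTop θ)) ?_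
    exact tendsto_map'_iff.2 (tendsto_const_nhds.congr fun k => (coe_add_two_pi_mul θ k).symm)
  · refine exists_tendsto_of_mem_Asharp f.2 (F := map (fun k : ℕ => θ - 2 * π * k) atTop) (θ := θ)
      (Or.inr (tendsto_sub_two_pi_mul_atBot θ)) ?_
    exact tendsto_map'_iff.2 (tendsto_const_nhds.congr fun k => (coe_sub_two_pi_mul θ k).symm)
  · obtain ⟨U, hU⟩ := exists_ultrafilter_tendsto_character isClosed_Asharp
      (fun _ => star_mem_Asharp) φ
    by_cases hfin : ∃ t : ℝ, (U : Filter ℝ) ≤ 𝓝 t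
    · obtain ⟨t, ht⟩ := hfin
      exact Or.inl ⟨t, fun f => tendsto_nhds_unique (hU f)
        (((f : ℝ →ᵇ ℂ).continuous.tendsto t).mono_left ht)⟩
    refine Or.inr ?_
    have : Fact (0 < 2 * π) := ⟨two_pi_pos⟩
    obtain ⟨z, hz⟩ : ∃ z : AddCircle (2 * π),
        Tendsto (fun x : ℝ => (x : AddCircle (2 * π))) U (𝓝 z) :=
      ⟨_, (U.map fun x : ℝ => (x : AddCircle (2 * π))).le_nhds_lim⟩
    obtain ⟨θ, rfl⟩ := QuotientAddGroup.mk_surjective z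
    have hinf : (U : Filter ℝ) ≤ atBot ⊔ atTop := by
      rw [← cocompact_eq_atBot_atTop]
      refine hasBasis_cocompact.ge_iff.2 fun K hK => Ultrafilter.compl_mem_iff_notMem.2 fun hKU => ?_
      obtain ⟨t, -, ht⟩ := isCompact_iff_ultrafilter_le_nhds'.1 hK U hKU
      exact hfin ⟨t, ht⟩
    rcases Ultrafilter.le_sup_iff.1 hinf with hU' | hU'
    · exact Or.inr ⟨θ, fun f => tendsto_comp_of_tendsto_Asharp f.2 (Or.inr rfl) hU' hz
        (tendsto_sub_two_pi_mul_atBot θ) (coe_sub_two_pi_mul θ) (hU f)⟩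
    · exact Or.inl ⟨θ, fun f => tendsto_comp_of_tendsto_Asharp f.2 (Or.inl rfl) hU' hz
        (tendsto_add_two_pi_mul_atTop θ) (coe_add_two_pi_mul θ) (hU f)⟩
  · refine (denseRange_evalCharacter isClosed_Asharp fun _ => star_mem_Asharp).mono ?_
    rintro _ ⟨t, rfl⟩
    exact ⟨t, fun _ => rfl⟩
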